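/- arXiv:2207.02358 — 2 statements merged into one kernel-verified Lean document; each statement's English description precedes it below -/
import Mathlib

section
/- Let Ω₀ ⊂ ℝ³ be a nonempty bounded open set. There exists a constant κ₁ > 0, depending only on Ω₀, such that for every u ∈ C_c^∞(ℝ³;ℝ³) with div u = 0 which is equal to a constant vector û on Ω₀, one has |û| ≤ κ₁ ‖D(u)‖_{L²(ℝ³)}. -/
noncomputable section
open MeasureTheory

/-- Three-dimensional Euclidean space. -/
abbrev E3 := EuclideanSpace ℝ (Fin 3)

/-- The `i`-th standard basis vector of `ℝ³`. -/
def ee (i : Fin 3) : E3 := EuclideanSpace.single i (1 : ℝ)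

/-- `|D(u)|² = Σ_{i,j} ((∂ᵢ uⱼ + ∂ⱼ uᵢ)/2)²`, the squared Frobenius norm of the
symmetric part of the gradient (stretching tensor). -/
def symGradSq (u : E3 → E3) (x : E3) : ℝ :=
  ∑ i : Fin 3, ∑ j : Fin 3, ((fderiv ℝ u x (ee i) j + fderiv ℝ u x (ee j) i) / 2) ^ 2

/-- The operator norm on `ℝ³` is bounded by the Frobenius norm. -/
lemma norm_sq_le_sum_sq_apply (L : E3 →L[ℝ] E3) :
    ‖L‖ ^ 2 ≤ ∑ i : Fin 3, ∑ j : Fin 3, (L (ee i) j) ^ 2 := by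
  have hL : ‖L‖ ≤ √(∑ i : Fin 3, ∑ j : Fin 3, (L (ee i) j) ^ 2) := by
    refine L.opNorm_le_bound (Real.sqrt_nonneg _) fun v => ?_
    have hv : v = ∑ i, v i • ee i := by
      ext k
      fin_cases k <;> simp [ee, Fin.sum_univ_three]
    have hcoord (j : Fin 3) : L v j = ∑ i, v i * L (ee i) j := by
      conv_lhs => rw [hv]
      simp [Fin.sum_univ_three]
    rw [EuclideanSpace.norm_eq, EuclideanSpace.norm_eq, ← Real.sqrt_mul (by positivity)]
    refine Real.sqrt_le_sqrt ?_
    simp only [Real.norm_eq_abs, sq_abs, hcoord]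
    rw [Finset.sum_comm, Finset.sum_mul]
    refine Finset.sum_le_sum fun j _ => ?_
    rw [mul_comm]
    exact Finset.sum_mul_sq_le_sq_mul_sq _ _ _
  calc ‖L‖ ^ 2 ≤ √(∑ i : Fin 3, ∑ j : Fin 3, (L (ee i) j) ^ 2) ^ 2 := by gcongr
    _ = _ := Real.sq_sqrt (by positivity)

/-- For a divergence-free test field `u`, the integral of `tr ((∇u)²)` vanishes. -/
lemma integral_sum_fderiv_mul_fderiv_eq_zero {u : E3 → E3} (hu : ContDiff ℝ (⊤ : ℕ∞) u)
    (hc : HasCompactSupport u) (hdiv : ∀ x, ∑ i : Fin 3, fderiv ℝ u x (ee i) i = 0) :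
    ∫ x, ∑ i : Fin 3, ∑ j : Fin 3, fderiv ℝ u x (ee i) j * fderiv ℝ u x (ee j) i = 0 := by
  have hd : Differentiable ℝ u := hu.differentiable (by simp)
  have hf : ContDiff ℝ 1 (fderiv ℝ u) := hu.fderiv_right (by norm_cast)
  have hfd : Differentiable ℝ (fderiv ℝ u) := hf.differentiable (by simp)
  have hff : Continuous (fderiv ℝ (fderiv ℝ u)) := hf.continuous_fderiv (by simp)
  have hdcoord (j : Fin 3) (x v : E3) : fderiv ℝ (fun y => u y j) x v = fderiv ℝ u x v j := by
    have h := ((EuclideanSpace.proj (𝕜 := ℝ) j : E3 →L[ℝ] ℝ).hasFDerivAt.comp x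
      (hd x).hasFDerivAt).fderiv
    exact congrArg (fun L => L v) h
  have hdpart (i j : Fin 3) (x v : E3) : fderiv ℝ (fun y => fderiv ℝ u y (ee j) i) x v =
      fderiv ℝ (fderiv ℝ u) x v (ee j) i := by
    have h := (((EuclideanSpace.proj (𝕜 := ℝ) i : E3 →L[ℝ] ℝ).comp
      (ContinuousLinearMap.apply ℝ E3 (ee j))).hasFDerivAt.comp x (hfd x).hasFDerivAt).fderiv
    exact congrArg (fun L => L v) h
  have hsupp (j : Fin 3) : HasCompactSupport fun x => u x j :=
    hc.comp_left (g := fun v : E3 => v j) rfl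
  have hsuppd (i j : Fin 3) : HasCompactSupport fun x => fderiv ℝ u x (ee i) j :=
    (hc.fderiv ℝ).comp_left (g := fun L : E3 →L[ℝ] E3 => L (ee i) j) rfl
  have hparts (i j : Fin 3) :
      Integrable (fun x => fderiv ℝ u x (ee i) j * fderiv ℝ u x (ee j) i) ∧
      Integrable (fun x => u x j * fderiv ℝ (fderiv ℝ u) x (ee i) (ee j) i) ∧
      ∫ x, fderiv ℝ u x (ee i) j * fderiv ℝ u x (ee j) i =
        -∫ x, u x j * fderiv ℝ (fderiv ℝ u) x (ee i) (ee j) i := by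
    have hI₁ : Integrable (fun x => fderiv ℝ u x (ee i) j * fderiv ℝ u x (ee j) i) :=
      Continuous.integrable_of_hasCompactSupport (by fun_prop) (hsuppd i j).mul_right
    have hI₂ : Integrable (fun x => u x j * fderiv ℝ (fderiv ℝ u) x (ee i) (ee j) i) :=
      Continuous.integrable_of_hasCompactSupport (by fun_prop) (hsupp j).mul_right
    have hI₃ : Integrable (fun x => u x j * fderiv ℝ u x (ee j) i) :=
      Continuous.integrable_of_hasCompactSupport (by fun_prop) (hsupp j).mul_right
    refine ⟨hI₁, hI₂, ?_⟩
    have h := integral_mul_fderiv_eq_neg_fderiv_mul_of_integrable (μ := volume)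
      (f := fun x => u x j) (g := fun x => fderiv ℝ u x (ee j) i) (v := ee i)
      (by simpa only [hdcoord] using hI₁) (by simpa only [hdpart] using hI₂) hI₃
      (fun x _ => by fun_prop) (fun x _ => by fun_prop)
    simp only [hdcoord, hdpart] at h
    rw [h, neg_neg]
  have hsymm (x v w : E3) :
      fderiv ℝ (fderiv ℝ u) x v w = fderiv ℝ (fderiv ℝ u) x w v :=
    hu.contDiffAt.isSymmSndFDerivAt
      (by simp only [minSmoothness_of_isRCLikeNormedField]; norm_cast) v w
  have hgraddiv (j : Fin 3) (x : E3) :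
      ∑ i : Fin 3, fderiv ℝ (fderiv ℝ u) x (ee i) (ee j) i = 0 := by
    have h : fderiv ℝ (fun y => ∑ i : Fin 3, fderiv ℝ u y (ee i) i) x (ee j) = 0 := by
      simp [hdiv]
    rw [fderiv_fun_sum (fun i _ => by fun_prop)] at h
    simpa only [sum_apply, hdpart, hsymm x (ee j)] using h
  rw [integral_finsetSum _ fun i _ => integrable_finsetSum _ fun j _ => (hparts i j).1]
  simp_rw [integral_finsetSum _ fun j _ => (hparts _ j).1, (hparts _ _).2.2]
  rw [Finset.sum_comm]
  refine Finset.sum_eq_zero fun j _ => ?_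
  rw [Finset.sum_neg_distrib, ← integral_finsetSum _ fun i _ => (hparts i j).2.1]
  simp [← Finset.mul_sum, hgraddiv]

/-- Korn's inequality (with constant `√2`) for divergence-free test fields. -/
lemma integral_norm_fderiv_sq_le {u : E3 → E3} (hu : ContDiff ℝ (⊤ : ℕ∞) u)
    (hc : HasCompactSupport u) (hdiv : ∀ x, ∑ i : Fin 3, fderiv ℝ u x (ee i) i = 0) :
    ∫ x, ‖fderiv ℝ u x‖ ^ 2 ≤ 2 * ∫ x, symGradSq u x := by
  have hf : Continuous (fderiv ℝ u) := hu.continuous_fderiv (by simp)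
  have hfc := hc.fderiv ℝ
  have hnorm : Integrable fun x => ‖fderiv ℝ u x‖ ^ 2 :=
    Continuous.integrable_of_hasCompactSupport (by fun_prop)
      (hfc.comp_left (g := fun L : E3 →L[ℝ] E3 => ‖L‖ ^ 2) (by simp))
  have hsym : Integrable (symGradSq u) :=
    Continuous.integrable_of_hasCompactSupport (by unfold symGradSq; fun_prop)
      (hfc.comp_left (g := fun L : E3 →L[ℝ] E3 =>
        ∑ i : Fin 3, ∑ j : Fin 3, ((L (ee i) j + L (ee j) i) / 2) ^ 2) (by simp))
  have htr : Integrable fun x =>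
      ∑ i : Fin 3, ∑ j : Fin 3, fderiv ℝ u x (ee i) j * fderiv ℝ u x (ee j) i :=
    Continuous.integrable_of_hasCompactSupport (by fun_prop)
      (hfc.comp_left (g := fun L : E3 →L[ℝ] E3 =>
        ∑ i : Fin 3, ∑ j : Fin 3, L (ee i) j * L (ee j) i) (by simp))
  calc ∫ x, ‖fderiv ℝ u x‖ ^ 2
      ≤ ∫ x, (2 * symGradSq u x -
          ∑ i : Fin 3, ∑ j : Fin 3, fderiv ℝ u x (ee i) j * fderiv ℝ u x (ee j) i) := by
        refine integral_mono hnorm ((hsym.const_mul 2).sub htr) fun x => ?_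
        refine (norm_sq_le_sum_sq_apply _).trans_eq ?_
        simp only [symGradSq, Fin.sum_univ_three]
        ring
    _ = 2 * ∫ x, symGradSq u x := by
        rw [integral_sub (hsym.const_mul 2) htr, integral_const_mul,
          integral_sum_fderiv_mul_fderiv_eq_zero hu hc hdiv, sub_zero]

/-- Let `Ω₀ ⊆ ℝ³` be a nonempty bounded open set. There is a constant `κ₁ > 0`,
depending only on `Ω₀`, such that every smooth, compactly supported, divergence-free
vector field `u` on `ℝ³` which is equal to a constant vector `û` on `Ω₀` satisfies
`|û| ≤ κ₁ ‖D(u)‖_{L²(ℝ³)}`. -/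
theorem rigid_velocity_le_symGrad_l2
    (Ω₀ : Set E3) (h₁ : Ω₀.Nonempty) (h₂ : Bornology.IsBounded Ω₀) (h₃ : IsOpen Ω₀) :
    ∃ κ₁ : ℝ, 0 < κ₁ ∧ ∀ (u : E3 → E3) (uhat : E3),
      ContDiff ℝ (⊤ : ℕ∞) u → HasCompactSupport u →
      (∀ x, ∑ i : Fin 3, fderiv ℝ u x (ee i) i = 0) →
      (∀ x ∈ Ω₀, u x = uhat) →
      ‖uhat‖ ≤ κ₁ * (∫ x, symGradSq u x) ^ (1/2 : ℝ) := by
  have hpos : 0 < (volume Ω₀).toReal :=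
    ENNReal.toReal_pos (h₃.measure_pos volume h₁).ne' h₂.measure_lt_top.ne
  set m : ℝ := (volume Ω₀).toReal ^ (1 / 6 : ℝ) with hm
  have hm0 : 0 < m := Real.rpow_pos_of_pos hpos _
  set C : ℝ := (SNormLESNormFDerivOfEqConst E3 (volume : Measure E3) 2).toReal with hC
  have hC0 : 0 ≤ C := NNReal.coe_nonneg _
  refine ⟨(C * √2 + 1) / m, by positivity, fun u uhat hu hc hdiv hconst => ?_⟩
  have hsob : eLpNorm u 6 volume ≤
      SNormLESNormFDerivOfEqConst E3 (volume : Measure E3) 2 *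
        eLpNorm (fderiv ℝ u) 2 volume := by
    have h := eLpNorm_le_eLpNorm_fderiv_of_eq (volume : Measure E3) (u := u) (p := 2) (p' := 6)
      (hu.of_le (by norm_cast)) hc (by norm_num) (by simp) (by simp; norm_num)
    exact_mod_cast h
  have hbody : ‖uhat‖ₑ * volume Ω₀ ^ (1 / 6 : ℝ) ≤ eLpNorm u 6 volume := by
    calc ‖uhat‖ₑ * volume Ω₀ ^ (1 / 6 : ℝ)
        = eLpNorm (fun _ : E3 => uhat) 6 (volume.restrict Ω₀) := by
          rw [eLpNorm_const' _ (by simp) (by simp)]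
          simp
      _ = eLpNorm u 6 (volume.restrict Ω₀) :=
          eLpNorm_congr_ae ((ae_restrict_mem h₃.measurableSet).mono fun x hx =>
            (hconst x hx).symm)
      _ ≤ eLpNorm u 6 volume := eLpNorm_mono_measure _ Measure.restrict_le_self
  have hf : Continuous (fderiv ℝ u) := hu.continuous_fderiv (by simp)
  have hgrad : MemLp (fderiv ℝ u) 2 volume := hf.memLp_of_hasCompactSupport (hc.fderiv ℝ)
  have hreal : ‖uhat‖ * m ≤ C * lpNorm (fderiv ℝ u) 2 volume := by
    have h := ENNReal.toReal_mono
      (ENNReal.mul_ne_top ENNReal.coe_ne_top hgrad.eLpNorm_ne_top) (hbody.trans hsob)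
    rw [ENNReal.toReal_mul, ENNReal.toReal_mul, ← ENNReal.toReal_rpow,
      toReal_eLpNorm hgrad.aestronglyMeasurable] at h
    simpa [hm, hC] using h
  have hkorn : lpNorm (fderiv ℝ u) 2 volume ≤ √2 * √(∫ x, symGradSq u x) := by
    rw [lpNorm_eq_integral_norm_rpow_toReal (by simp) (by simp) hgrad.aestronglyMeasurable,
      ← Real.sqrt_mul (by norm_num)]
    simpa [Real.sqrt_eq_rpow] using
      Real.sqrt_le_sqrt (integral_norm_fderiv_sq_le hu hc hdiv)
  rw [← Real.sqrt_eq_rpow, div_mul_eq_mul_div, le_div_iff₀ hm0]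
  calc ‖uhat‖ * m ≤ C * (√2 * √(∫ x, symGradSq u x)) :=
        hreal.trans (by gcongr)
    _ ≤ (C * √2 + 1) * √(∫ x, symGradSq u x) := by
        nlinarith [Real.sqrt_nonneg (∫ x, symGradSq u x)]
end
end

section
/- For each q ∈ [2, 6] there exists a constant c > 0, depending only on Ω and q, such that for every u ∈ C_c^∞(Ω;ℝ³) with div u = 0 one has ‖u‖_{L^∞(Ω)} + ‖∇u‖_{L^q(Ω)} ≤ c ( ‖∇u‖_{L²(Ω)} + |∂₁u|_{-1,2} + ‖D²u‖_{L²(Ω)} ). -/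
noncomputable section
open MeasureTheory Metric

/-- `Ω₀` has boundary of class `C²`: near each boundary point, after a rigid motion
(an isometry of `ℝ³`), `Ω₀` coincides with the subgraph of a `C²` function. -/
def IsC2Boundary (Ω₀ : Set E3) : Prop :=
  ∀ x ∈ frontier Ω₀, ∃ (e : E3 ≃ᵢ E3) (r : ℝ) (g : ℝ × ℝ → ℝ),
    0 < r ∧ ContDiff ℝ 2 g ∧
    ∀ y ∈ ball x r, (y ∈ Ω₀ ↔ e y 2 < g (e y 0, e y 1))

/-- The exterior domain `Ω = ℝ³ \ closure Ω₀`. -/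
def extDomain (Ω₀ : Set E3) : Set E3 := (closure Ω₀)ᶜ

/-- `u` is a smooth, compactly supported, divergence-free vector field with support in `Ω`. -/
def IsDivFreeTest (Ω : Set E3) (u : E3 → E3) : Prop :=
  ContDiff ℝ (⊤ : ℕ∞) u ∧ HasCompactSupport u ∧ tsupport u ⊆ Ω ∧
    ∀ x, ∑ i : Fin 3, fderiv ℝ u x (ee i) i = 0

/-- `|∇u|² = Σ_{i,j} (∂ᵢ uⱼ)²`, the squared Frobenius norm of the gradient. -/
def gradSq (u : E3 → E3) (x : E3) : ℝ :=
  ∑ i : Fin 3, ∑ j : Fin 3, (fderiv ℝ u x (ee i) j) ^ 2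

/-- `|D²u|² = Σ_{i,j,k} (∂ᵢ∂ⱼ u_k)²`, the squared Frobenius norm of the array of
second derivatives. -/
def hessSq (u : E3 → E3) (x : E3) : ℝ :=
  ∑ i : Fin 3, ∑ j : Fin 3, ‖fderiv ℝ (fun y => fderiv ℝ u y (ee j)) x (ee i)‖ ^ 2

/-- The negative-order seminorm
`|∂₁u|_{-1,2} = sup { |∫_Ω (∂₁u)·φ| : φ ∈ C_c^∞(Ω), div φ = 0, ‖∇φ‖_{L²(Ω)} ≤ 1 }`. -/
def negSob (Ω : Set E3) (u : E3 → E3) : ℝ :=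
  sSup {r : ℝ | ∃ φ : E3 → E3, IsDivFreeTest Ω φ ∧
    (∫ x in Ω, gradSq φ x) ^ (1/2 : ℝ) ≤ 1 ∧
    r = |∫ x in Ω, ∑ j : Fin 3, fderiv ℝ u x (ee 0) j * φ x j|}

open scoped ENNReal NNReal

lemma opNorm_le_sqrt_sum_norm_sq (L : E3 →L[ℝ] E3) :
    ‖L‖ ≤ Real.sqrt (∑ i : Fin 3, ‖L (ee i)‖ ^ 2) := by
  refine L.opNorm_le_bound (Real.sqrt_nonneg _) fun v => ?_
  have hv : v = ∑ i : Fin 3, v i • ee i := by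
    ext j
    fin_cases j <;> simp [ee, Fin.sum_univ_three]
  calc ‖L v‖ = ‖∑ i : Fin 3, v i • L (ee i)‖ := by
        conv_lhs => rw [hv]
        simp only [map_sum, map_smul]
    _ ≤ ∑ i : Fin 3, ‖L (ee i)‖ * |v i| := by
        refine (norm_sum_le _ _).trans (le_of_eq ?_)
        simp only [norm_smul, Real.norm_eq_abs, mul_comm]
    _ ≤ Real.sqrt (∑ i : Fin 3, ‖L (ee i)‖ ^ 2) * Real.sqrt (∑ i : Fin 3, |v i| ^ 2) :=
        Real.sum_mul_le_sqrt_mul_sqrt _ _ _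
    _ = _ := by
        rw [EuclideanSpace.norm_eq v]
        simp only [Real.norm_eq_abs]

lemma gradSq_eq_sum_norm_sq (u : E3 → E3) (x : E3) :
    gradSq u x = ∑ i : Fin 3, ‖fderiv ℝ u x (ee i)‖ ^ 2 := by
  simp only [gradSq, EuclideanSpace.real_norm_sq_eq]

lemma gradSq_nonneg (u : E3 → E3) (x : E3) : 0 ≤ gradSq u x := by
  unfold gradSq; positivity

lemma hessSq_nonneg (u : E3 → E3) (x : E3) : 0 ≤ hessSq u x := by
  unfold hessSq; positivity

lemma norm_fderiv_le_sqrt_gradSq (u : E3 → E3) (x : E3) :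
    ‖fderiv ℝ u x‖ ≤ Real.sqrt (gradSq u x) := by
  rw [gradSq_eq_sum_norm_sq]
  exact opNorm_le_sqrt_sum_norm_sq _

lemma norm_fderiv_partial_le_sqrt_hessSq (u : E3 → E3) (j : Fin 3) (x : E3) :
    ‖fderiv ℝ (fun y => fderiv ℝ u y (ee j)) x‖ ≤ Real.sqrt (hessSq u x) := by
  refine (opNorm_le_sqrt_sum_norm_sq _).trans (Real.sqrt_le_sqrt ?_)
  refine Finset.sum_le_sum fun i _ => ?_
  exact Finset.single_le_sum
    (f := fun j => ‖fderiv ℝ (fun y => fderiv ℝ u y (ee j)) x (ee i)‖ ^ 2)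
    (fun _ _ => by positivity) (Finset.mem_univ j)

lemma sqrt_gradSq_le_sum_norm (u : E3 → E3) (x : E3) :
    Real.sqrt (gradSq u x) ≤ ∑ i : Fin 3, ‖fderiv ℝ u x (ee i)‖ := by
  rw [gradSq_eq_sum_norm_sq]
  refine Real.sqrt_le_iff.2 ⟨by positivity, ?_⟩
  exact Finset.sum_sq_le_sq_sum_of_nonneg fun _ _ => norm_nonneg _

lemma contDiff_partial {u : E3 → E3} (hu : ContDiff ℝ (⊤ : ℕ∞) u) (j : Fin 3) :
    ContDiff ℝ (⊤ : ℕ∞) (fun y => fderiv ℝ u y (ee j)) :=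
  (hu.fderiv_right (m := (⊤ : ℕ∞)) (by simp)).clm_apply contDiff_const

lemma hasCompactSupport_partial {u : E3 → E3} (hc : HasCompactSupport u) (j : Fin 3) :
    HasCompactSupport (fun y => fderiv ℝ u y (ee j)) :=
  hc.fderiv_apply ℝ (ee j)

lemma continuous_gradSq {u : E3 → E3} (hu : ContDiff ℝ (⊤ : ℕ∞) u) :
    Continuous (gradSq u) := by
  have : gradSq u = fun x => ∑ i : Fin 3, ‖fderiv ℝ u x (ee i)‖ ^ 2 :=
    funext (gradSq_eq_sum_norm_sq u)
  rw [this]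
  exact continuous_finsetSum _ fun i _ => ((contDiff_partial hu i).continuous.norm.pow 2)

lemma continuous_hessSq {u : E3 → E3} (hu : ContDiff ℝ (⊤ : ℕ∞) u) :
    Continuous (hessSq u) :=
  continuous_finsetSum _ fun i _ => continuous_finsetSum _ fun j _ =>
    ((contDiff_partial (contDiff_partial hu j) i).continuous.norm.pow 2)

lemma gradSq_eq_zero_of_notMem_tsupport {u : E3 → E3} {x : E3} (hx : x ∉ tsupport u) :
    gradSq u x = 0 := by
  simp [gradSq, fderiv_of_notMem_tsupport ℝ hx]

lemma hessSq_eq_zero_of_notMem_tsupport {u : E3 → E3} {x : E3} (hx : x ∉ tsupport u) :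
    hessSq u x = 0 := by
  have h (j : Fin 3) : x ∉ tsupport (fun y => fderiv ℝ u y (ee j)) :=
    fun h => hx (tsupport_fderiv_apply_subset ℝ (ee j) h)
  simp [hessSq, fderiv_of_notMem_tsupport ℝ (h _)]

lemma hasCompactSupport_gradSq {u : E3 → E3} (hc : HasCompactSupport u) :
    HasCompactSupport (gradSq u) :=
  HasCompactSupport.intro hc fun _ => gradSq_eq_zero_of_notMem_tsupport

lemma hasCompactSupport_hessSq {u : E3 → E3} (hc : HasCompactSupport u) :
    HasCompactSupport (hessSq u) :=
  HasCompactSupport.intro hc fun _ => hessSq_eq_zero_of_notMem_tsupport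

/-- The Gagliardo–Nirenberg–Sobolev inequality `‖v‖₆ ≤ C ‖∇v‖₂` on `ℝ³`. -/
lemma eLpNorm_six_le_eLpNorm_fderiv_two {v : E3 → E3} (hv : ContDiff ℝ (⊤ : ℕ∞) v)
    (hc : HasCompactSupport v) :
    eLpNorm v 6 volume ≤
      SNormLESNormFDerivOfEqConst E3 (volume : Measure E3) 2 *
        eLpNorm (fderiv ℝ v) 2 volume := by
  have := eLpNorm_le_eLpNorm_fderiv_of_eq (volume : Measure E3) (p := 2) (p' := 6)
    (hv.of_le (by exact_mod_cast le_top)) hc (by norm_num) (by simp) (by simp; norm_num)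
  simpa using this

/-- `‖∇u‖₆ ≤ C ‖D²u‖₂` on `ℝ³`. -/
lemma eLpNorm_six_sqrt_gradSq_le {u : E3 → E3} (hu : ContDiff ℝ (⊤ : ℕ∞) u)
    (hc : HasCompactSupport u) :
    eLpNorm (fun x => Real.sqrt (gradSq u x)) 6 volume ≤
      3 * (SNormLESNormFDerivOfEqConst E3 (volume : Measure E3) 2 *
        eLpNorm (fun x => Real.sqrt (hessSq u x)) 2 volume) := by
  have hsum : eLpNorm (fun x => Real.sqrt (gradSq u x)) 6 volume ≤
      eLpNorm (∑ i : Fin 3, fun x => ‖fderiv ℝ u x (ee i)‖) 6 volume := by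
    refine eLpNorm_mono_real fun x => ?_
    rw [Real.norm_eq_abs, abs_of_nonneg (Real.sqrt_nonneg _), Finset.sum_apply]
    exact sqrt_gradSq_le_sum_norm u x
  refine hsum.trans ((eLpNorm_sum_le (fun i _ =>
    (contDiff_partial hu i).continuous.norm.aestronglyMeasurable) (by norm_num)).trans ?_)
  have key (i : Fin 3) : eLpNorm (fun x => ‖fderiv ℝ u x (ee i)‖) 6 volume ≤
      SNormLESNormFDerivOfEqConst E3 (volume : Measure E3) 2 *
        eLpNorm (fun x => Real.sqrt (hessSq u x)) 2 volume := by
    rw [eLpNorm_norm]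
    refine (eLpNorm_six_le_eLpNorm_fderiv_two (contDiff_partial hu i)
      (hasCompactSupport_partial hc i)).trans ?_
    gcongr
    exact eLpNorm_mono_real (norm_fderiv_partial_le_sqrt_hessSq u i)
  refine (Finset.sum_le_sum fun i _ => key i).trans ?_
  simp

lemma eLpNorm_six_comp_add_smul {F : Type*} [NormedAddCommGroup F] {f : E3 → F}
    (hf : Continuous f) (x : E3) {t : ℝ} (ht : 0 < t) :
    eLpNorm (fun y => f (x + t • y)) 6 volume =
      ENNReal.ofReal (t ^ (-(1 / 2) : ℝ)) * eLpNorm f 6 volume := by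
  have h1 : eLpNorm (fun y => f (x + t • y)) 6 volume =
      eLpNorm (fun y => f (x + y)) 6 (Measure.map (fun y : E3 => t • y) volume) := by
    rw [eLpNorm_map_measure]
    · rfl
    · exact (hf.comp (continuous_const.add continuous_id)).aestronglyMeasurable
    · exact (continuous_const_smul t).aemeasurable
  have h2 : eLpNorm (fun y => f (x + y)) 6 volume = eLpNorm f 6 volume :=
    eLpNorm_comp_measurePreserving hf.aestronglyMeasurable
      (measurePreserving_add_left (volume : Measure E3) x)
  rw [h1, Measure.map_addHaar_smul _ ht.ne', eLpNorm_smul_measure_of_ne_top (by simp), h2,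
    smul_eq_mul, ENNReal.ofReal_rpow_of_nonneg (by positivity) (by positivity)]
  congr 2
  rw [abs_of_pos (by positivity)]
  simp only [finrank_euclideanSpace, Fintype.card_fin, one_div, ENNReal.toReal_inv,
    ENNReal.toReal_ofNat]
  rw [← Real.rpow_natCast, ← Real.rpow_neg ht.le, ← Real.rpow_mul ht.le]
  norm_num

lemma enorm_le_enorm_add_lintegral_fderiv {u : E3 → E3} (hu : ContDiff ℝ (⊤ : ℕ∞) u)
    (x : E3) {y : E3} (hy : y ∈ ball (0 : E3) 1) :
    ‖u x‖ₑ ≤ ‖u (x + y)‖ₑ + ∫⁻ t in Set.Ioc (0 : ℝ) 1, ‖fderiv ℝ u (x + t • y)‖ₑ := by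
  have hd (t : ℝ) : HasDerivAt (fun s : ℝ => u (x + s • y)) (fderiv ℝ u (x + t • y) y) t := by
    have h1 : HasDerivAt (fun s : ℝ => x + s • y) y t := by
      simpa using ((hasDerivAt_id t).smul_const y).const_add x
    exact ((hu.differentiable (by simp)) (x + t • y)).hasFDerivAt.comp_hasDerivAt t h1
  have hcont : Continuous fun t : ℝ => fderiv ℝ u (x + t • y) y :=
    ((hu.continuous_fderiv (by simp)).comp (by fun_prop)).clm_apply continuous_const
  have hftc := intervalIntegral.integral_eq_sub_of_hasDerivAt (a := 0) (b := 1)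
    (fun t _ => hd t) (hcont.intervalIntegrable 0 1)
  simp only [one_smul, zero_smul, add_zero] at hftc
  have hux : u x = u (x + y) - ∫ t in (0 : ℝ)..1, fderiv ℝ u (x + t • y) y := by
    rw [hftc]; abel
  rw [hux]
  refine enorm_sub_le.trans ?_
  gcongr
  rw [intervalIntegral.integral_of_le zero_le_one]
  refine (enorm_integral_le_lintegral_enorm _).trans (lintegral_mono fun t => ?_)
  rw [mem_ball_zero_iff] at hy
  rw [enorm_le_iff_norm_le]
  refine ((fderiv ℝ u (x + t • y)).le_opNorm y).trans ?_
  exact mul_le_of_le_one_right (norm_nonneg _) hy.le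

lemma lintegral_ball_enorm_le {F : Type*} [NormedAddCommGroup F] {f : E3 → F}
    (hf : Continuous f) :
    ∫⁻ y in ball (0 : E3) 1, ‖f y‖ₑ ≤
      eLpNorm f 6 volume * volume (ball (0 : E3) 1) ^ (5 / 6 : ℝ) := by
  have h := eLpNorm_le_eLpNorm_mul_rpow_measure_univ (p := 1) (q := 6)
    (μ := volume.restrict (ball (0 : E3) 1)) (by norm_num) hf.aestronglyMeasurable
  rw [eLpNorm_one_eq_lintegral_enorm, Measure.restrict_apply_univ] at h
  refine h.trans ?_
  have : (1 / (1 : ℝ≥0∞).toReal - 1 / (6 : ℝ≥0∞).toReal) = (5 / 6 : ℝ) := by norm_num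
  rw [this]
  gcongr
  exact Measure.restrict_le_self

/-- Morrey's inequality on `ℝ³`, in the form `W^{1,6} ⊂ L^∞`. -/
lemma exists_enorm_le_eLpNorm_six_add :
    ∃ C : ℝ≥0∞, C ≠ ∞ ∧ ∀ u : E3 → E3, ContDiff ℝ (⊤ : ℕ∞) u → ∀ x,
      ‖u x‖ₑ ≤ C * (eLpNorm u 6 volume + eLpNorm (fderiv ℝ u) 6 volume) := by
  set V := volume (ball (0 : E3) 1) with hV
  have hV0 : V ≠ 0 := (measure_ball_pos _ _ one_pos).ne'
  have hVt : V ≠ ∞ := measure_ball_lt_top.ne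
  set K := ∫⁻ t in Set.Ioc (0 : ℝ) 1, ENNReal.ofReal (t ^ (-(1 / 2) : ℝ)) with hK
  have hKt : K ≠ ∞ := by
    have hi : IntervalIntegrable (fun t : ℝ => t ^ (-(1 / 2) : ℝ)) volume 0 1 :=
      intervalIntegral.intervalIntegrable_rpow' (by norm_num)
    rw [intervalIntegrable_iff_integrableOn_Ioc_of_le zero_le_one] at hi
    exact (Integrable.lintegral_lt_top hi).ne
  refine ⟨V⁻¹ * (V ^ (5 / 6 : ℝ) * (1 + K)), ?_, fun u hu x => ?_⟩
  · refine ENNReal.mul_ne_top (ENNReal.inv_ne_top.2 hV0) (ENNReal.mul_ne_top ?_ ?_)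
    · exact ENNReal.rpow_ne_top_of_nonneg (by norm_num) hVt
    · exact ENNReal.add_ne_top.2 ⟨by simp, hKt⟩
  have hDc : Continuous (fderiv ℝ u) := hu.continuous_fderiv (by simp)
  set P := eLpNorm u 6 volume
  set Q := eLpNorm (fderiv ℝ u) 6 volume
  have h1 : ∫⁻ y in ball (0 : E3) 1, ‖u (x + y)‖ₑ ≤ P * V ^ (5 / 6 : ℝ) := by
    refine (lintegral_ball_enorm_le (f := fun y => u (x + y))
      (hu.continuous.comp (by fun_prop))).trans (le_of_eq ?_)
    have := eLpNorm_six_comp_add_smul hu.continuous x one_pos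
    simp only [one_smul, Real.one_rpow, ENNReal.ofReal_one, one_mul] at this
    rw [this]
  have h2 : ∫⁻ y in ball (0 : E3) 1, ∫⁻ t in Set.Ioc (0 : ℝ) 1, ‖fderiv ℝ u (x + t • y)‖ₑ ≤
      K * (Q * V ^ (5 / 6 : ℝ)) := by
    rw [lintegral_lintegral_swap]
    · rw [hK, ← lintegral_mul_const _ (by fun_prop)]
      refine setLIntegral_mono' measurableSet_Ioc fun t ht => ?_
      refine (lintegral_ball_enorm_le (f := fun y => fderiv ℝ u (x + t • y))
        (hDc.comp (by fun_prop))).trans (le_of_eq ?_)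
      rw [eLpNorm_six_comp_add_smul hDc x ht.1, mul_assoc]
    · refine Continuous.aemeasurable ?_
      exact (hDc.comp (by fun_prop)).enorm
  have h3 : V * ‖u x‖ₑ ≤ P * V ^ (5 / 6 : ℝ) + K * (Q * V ^ (5 / 6 : ℝ)) := by
    calc V * ‖u x‖ₑ = ∫⁻ _ in ball (0 : E3) 1, ‖u x‖ₑ := by
          rw [setLIntegral_const, mul_comm]
      _ ≤ ∫⁻ y in ball (0 : E3) 1,
            (‖u (x + y)‖ₑ + ∫⁻ t in Set.Ioc (0 : ℝ) 1, ‖fderiv ℝ u (x + t • y)‖ₑ) :=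
          setLIntegral_mono' measurableSet_ball fun y hy =>
            enorm_le_enorm_add_lintegral_fderiv hu x hy
      _ ≤ _ := by
          rw [lintegral_add_left]
          · exact add_le_add h1 h2
          · exact ((hu.continuous.comp (by fun_prop)).enorm).measurable
  calc ‖u x‖ₑ = V⁻¹ * (V * ‖u x‖ₑ) := by
        rw [← mul_assoc, ENNReal.inv_mul_cancel hV0 hVt, one_mul]
    _ ≤ V⁻¹ * (V ^ (5 / 6 : ℝ) * (1 + K) * (P + Q)) := by
        refine mul_le_mul_right (h3.trans ?_) _
        have : V ^ (5 / 6 : ℝ) * (1 + K) * (P + Q) =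
          (P * V ^ (5 / 6 : ℝ) + K * (Q * V ^ (5 / 6 : ℝ))) +
          (Q * V ^ (5 / 6 : ℝ) + K * (P * V ^ (5 / 6 : ℝ))) := by ring
        rw [this]
        exact le_self_add
    _ = _ := by ring

lemma eLpNorm_eq_ofReal_integral_rpow {g : E3 → ℝ} (hg : Continuous g)
    (hc : HasCompactSupport g) (h0 : ∀ x, 0 ≤ g x) {p : ℝ≥0∞} (hp0 : p ≠ 0) (hp : p ≠ ∞) :
    eLpNorm g p volume = ENNReal.ofReal ((∫ x, g x ^ p.toReal) ^ p.toReal⁻¹) := by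
  rw [(hg.memLp_of_hasCompactSupport hc).eLpNorm_eq_integral_rpow_norm hp0 hp]
  simp only [Real.norm_of_nonneg (h0 _)]

lemma hasCompactSupport_sqrt {f : E3 → ℝ} (hc : HasCompactSupport f) :
    HasCompactSupport fun x => Real.sqrt (f x) :=
  hc.comp_left Real.sqrt_zero

lemma eLpNorm_two_sqrt {f : E3 → ℝ} (hf : Continuous f) (hc : HasCompactSupport f)
    (h0 : ∀ x, 0 ≤ f x) :
    eLpNorm (fun x => Real.sqrt (f x)) 2 volume =
      ENNReal.ofReal ((∫ x, f x) ^ (1 / 2 : ℝ)) := by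
  rw [eLpNorm_eq_ofReal_integral_rpow hf.sqrt (hasCompactSupport_sqrt hc)
    (fun _ => Real.sqrt_nonneg _) (by simp) (by simp)]
  simp [Real.sq_sqrt (h0 _)]

/-- Interpolation of `L^q` between `L²` and `L⁶`. -/
lemma integral_rpow_rpow_inv_le {g : E3 → ℝ} (hg : Continuous g) (hc : HasCompactSupport g)
    (h0 : ∀ x, 0 ≤ g x) {q : ℝ} (hq2 : 2 ≤ q) (hq6 : q ≤ 6) {M D : ℝ} (hM : 0 < M)
    (h2 : ∫ x, g x ^ 2 ≤ M ^ 2) (h6 : ∫ x, g x ^ 6 ≤ (D * M) ^ 6) :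
    (∫ x, g x ^ q) ^ (1 / q) ≤ (1 + D ^ 6) ^ (1 / q) * M := by
  have hint (n : ℕ) (hn : n ≠ 0) : Integrable fun x => g x ^ n :=
    (hg.pow n).integrable_of_hasCompactSupport (hc.comp_left (g := fun s : ℝ => s ^ n)
      (by simp [hn]))
  have hpt (s : ℝ) (hs : 0 ≤ s) : s ^ q ≤ s ^ 2 + s ^ 6 := by
    rcases hs.eq_or_lt with rfl | hs'
    · rw [Real.zero_rpow (by linarith)]; simp
    rcases le_total s 1 with h | h
    · have := Real.rpow_le_rpow_of_exponent_ge hs' h hq2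
      rw [Real.rpow_two] at this
      nlinarith [pow_nonneg hs 6]
    · have := Real.rpow_le_rpow_of_exponent_le h hq6
      rw [show (6 : ℝ) = ((6 : ℕ) : ℝ) by norm_num, Real.rpow_natCast] at this
      nlinarith [sq_nonneg s]
  have hle (x : E3) : g x ^ q ≤ M ^ q * (g x ^ 2 / M ^ 2 + g x ^ 6 / M ^ 6) := by
    have h := hpt (g x / M) (div_nonneg (h0 x) hM.le)
    rw [Real.div_rpow (h0 x) hM.le, div_pow, div_pow, div_le_iff₀ (by positivity)] at h
    linarith
  have hI : ∫ x, g x ^ q ≤ M ^ q * (1 + D ^ 6) := by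
    calc ∫ x, g x ^ q ≤ ∫ x, M ^ q * (g x ^ 2 / M ^ 2 + g x ^ 6 / M ^ 6) := by
          refine integral_mono_of_nonneg (Filter.Eventually.of_forall fun x =>
            Real.rpow_nonneg (h0 x) q) ?_ (Filter.Eventually.of_forall hle)
          exact (((hint 2 (by simp)).div_const _).add ((hint 6 (by simp)).div_const _)).const_mul _
      _ = M ^ q * ((∫ x, g x ^ 2) / M ^ 2 + (∫ x, g x ^ 6) / M ^ 6) := by
          rw [integral_const_mul, integral_add ((hint 2 (by simp)).div_const _)
            ((hint 6 (by simp)).div_const _), integral_div, integral_div]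
      _ ≤ M ^ q * (1 + D ^ 6) := by
          gcongr
          · rwa [div_le_one (by positivity)]
          · rwa [div_le_iff₀ (by positivity), ← mul_pow]
  have hq : 0 < q := by linarith
  calc (∫ x, g x ^ q) ^ (1 / q) ≤ (M ^ q * (1 + D ^ 6)) ^ (1 / q) := by
        refine Real.rpow_le_rpow (integral_nonneg fun x => Real.rpow_nonneg (h0 x) q) hI
          (by positivity)
    _ = (1 + D ^ 6) ^ (1 / q) * M := by
        rw [Real.mul_rpow (by positivity) (by positivity), ← Real.rpow_mul hM.le,
          mul_one_div_cancel hq.ne', Real.rpow_one, mul_comm]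

lemma negSob_nonneg (Ω : Set E3) (u : E3 → E3) : 0 ≤ negSob Ω u := by
  refine Real.sSup_nonneg ?_
  rintro r ⟨φ, -, -, rfl⟩
  exact abs_nonneg _

/-- `‖u‖_∞ ≤ C (‖∇u‖₂ + ‖D²u‖₂)` on `ℝ³`. -/
lemma exists_norm_le_gradSq_add_hessSq :
    ∃ C : ℝ, 0 ≤ C ∧ ∀ u : E3 → E3, ContDiff ℝ (⊤ : ℕ∞) u → HasCompactSupport u → ∀ x,
      ‖u x‖ ≤ C * ((∫ x, gradSq u x) ^ (1 / 2 : ℝ) + (∫ x, hessSq u x) ^ (1 / 2 : ℝ)) := by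
  obtain ⟨C, hC, h⟩ := exists_enorm_le_eLpNorm_six_add
  set S := SNormLESNormFDerivOfEqConst E3 (volume : Measure E3) 2
  refine ⟨C.toReal * (3 * S), by positivity, fun u hu hc x => ?_⟩
  have hA : 0 ≤ (∫ x, gradSq u x) ^ (1 / 2 : ℝ) :=
    Real.rpow_nonneg (integral_nonneg (gradSq_nonneg u)) _
  have hH : 0 ≤ (∫ x, hessSq u x) ^ (1 / 2 : ℝ) :=
    Real.rpow_nonneg (integral_nonneg (hessSq_nonneg u)) _
  have h1 : eLpNorm u 6 volume ≤
      3 * (S * ENNReal.ofReal ((∫ x, gradSq u x) ^ (1 / 2 : ℝ))) := by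
    rw [← eLpNorm_two_sqrt (continuous_gradSq hu) (hasCompactSupport_gradSq hc)
      (gradSq_nonneg u)]
    refine (eLpNorm_six_le_eLpNorm_fderiv_two hu hc).trans ?_
    refine le_trans ?_ (le_mul_of_one_le_left (by simp) (by norm_num))
    gcongr
    exact eLpNorm_mono_real (norm_fderiv_le_sqrt_gradSq u)
  have h2 : eLpNorm (fderiv ℝ u) 6 volume ≤
      3 * (S * ENNReal.ofReal ((∫ x, hessSq u x) ^ (1 / 2 : ℝ))) := by
    rw [← eLpNorm_two_sqrt (continuous_hessSq hu) (hasCompactSupport_hessSq hc)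
      (hessSq_nonneg u)]
    exact (eLpNorm_mono_real (norm_fderiv_le_sqrt_gradSq u)).trans
      (eLpNorm_six_sqrt_gradSq_le hu hc)
  rw [← ENNReal.ofReal_le_ofReal_iff (by positivity), ofReal_norm]
  refine (h u hu x).trans ((mul_le_mul_right (add_le_add h1 h2) C).trans (le_of_eq ?_))
  rw [ENNReal.ofReal_mul (by positivity), ENNReal.ofReal_mul (by positivity),
    ENNReal.ofReal_mul (by positivity), ENNReal.ofReal_add hA hH, ENNReal.ofReal_toReal hC,
    ENNReal.ofReal_coe_nnreal]
  simp only [ENNReal.ofReal_ofNat]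
  ring

lemma integral_sqrt_gradSq_pow_six_le {u : E3 → E3} (hu : ContDiff ℝ (⊤ : ℕ∞) u)
    (hc : HasCompactSupport u) :
    ∫ x, Real.sqrt (gradSq u x) ^ 6 ≤
      (3 * SNormLESNormFDerivOfEqConst E3 (volume : Measure E3) 2 *
        (∫ x, hessSq u x) ^ (1 / 2 : ℝ)) ^ 6 := by
  set S := SNormLESNormFDerivOfEqConst E3 (volume : Measure E3) 2
  have h := eLpNorm_six_sqrt_gradSq_le hu hc
  have hH : 0 ≤ (∫ x, hessSq u x) ^ (1 / 2 : ℝ) :=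
    Real.rpow_nonneg (integral_nonneg (hessSq_nonneg u)) _
  have hG : 0 ≤ ∫ x, Real.sqrt (gradSq u x) ^ 6 := integral_nonneg fun x => by positivity
  rw [eLpNorm_two_sqrt (continuous_hessSq hu) (hasCompactSupport_hessSq hc) (hessSq_nonneg u),
    eLpNorm_eq_ofReal_integral_rpow (continuous_gradSq hu).sqrt
      (hasCompactSupport_sqrt (hasCompactSupport_gradSq hc)) (fun _ => Real.sqrt_nonneg _)
      (by simp) (by simp), ← ENNReal.ofReal_coe_nnreal, ← ENNReal.ofReal_mul (by positivity),
    show (3 : ℝ≥0∞) = ENNReal.ofReal 3 by simp, ← ENNReal.ofReal_mul (by positivity),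
    ENNReal.ofReal_le_ofReal_iff (by positivity)] at h
  have e6 : (6 : ℝ≥0∞).toReal = ((6 : ℕ) : ℝ) := by simp
  simp only [e6, Real.rpow_natCast] at h
  calc ∫ x, Real.sqrt (gradSq u x) ^ 6
      = ((∫ x, Real.sqrt (gradSq u x) ^ 6) ^ (((6 : ℕ) : ℝ)⁻¹)) ^ 6 :=
        (Real.rpow_inv_natCast_pow hG (by simp)).symm
    _ ≤ _ := by
        rw [mul_assoc]
        gcongr

/-- Embedding `X²(Ω) ⊂ L^∞(Ω) ∩ D^{1,q}(Ω)` for `q ∈ [2,6]` (Lemma 2.4), on the dense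
class of smooth compactly supported divergence-free fields:
`‖u‖_{L^∞(Ω)} + ‖∇u‖_{L^q(Ω)} ≤ c (‖∇u‖_{L²(Ω)} + |∂₁u|_{-1,2} + ‖D²u‖_{L²(Ω)})`. -/
theorem linfty_d1q_embedding_of_X2
    (Ω₀ : Set E3) (h₁ : Ω₀.Nonempty) (h₂ : Bornology.IsBounded Ω₀) (h₃ : IsOpen Ω₀)
    (h₄ : IsC2Boundary Ω₀) (q : ℝ) (hq2 : 2 ≤ q) (hq6 : q ≤ 6) :
    ∃ c : ℝ, 0 < c ∧ ∀ u : E3 → E3, IsDivFreeTest (extDomain Ω₀) u →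
      (⨆ x : E3, ‖u x‖) +
          (∫ x in extDomain Ω₀, Real.sqrt (gradSq u x) ^ q) ^ (1/q : ℝ) ≤
        c * ((∫ x in extDomain Ω₀, gradSq u x) ^ (1/2 : ℝ) + negSob (extDomain Ω₀) u +
          (∫ x in extDomain Ω₀, hessSq u x) ^ (1/2 : ℝ)) := by
  obtain ⟨C, hC0, hC⟩ := exists_norm_le_gradSq_add_hessSq
  set S := SNormLESNormFDerivOfEqConst E3 (volume : Measure E3) 2 with hS
  set K : ℝ := (1 + (3 * (S : ℝ)) ^ 6) ^ (1 / q) with hK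
  have hK0 : 0 < K := by positivity
  refine ⟨C + K, by positivity, fun u hu => ?_⟩
  obtain ⟨hsm, hc, hsub, -⟩ := hu
  have hq : q ≠ 0 := by linarith
  rw [setIntegral_eq_integral_of_forall_compl_eq_zero (f := gradSq u) fun x hx =>
      gradSq_eq_zero_of_notMem_tsupport fun h => hx (hsub h),
    setIntegral_eq_integral_of_forall_compl_eq_zero (f := hessSq u) fun x hx =>
      hessSq_eq_zero_of_notMem_tsupport fun h => hx (hsub h),
    setIntegral_eq_integral_of_forall_compl_eq_zero (f := fun x => Real.sqrt (gradSq u x) ^ q)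
      fun x hx => by
        rw [gradSq_eq_zero_of_notMem_tsupport fun h => hx (hsub h), Real.sqrt_zero,
          Real.zero_rpow hq]]
  have hN := negSob_nonneg (extDomain Ω₀) u
  set N := negSob (extDomain Ω₀) u
  have hG0 : 0 ≤ ∫ x, gradSq u x := integral_nonneg (gradSq_nonneg u)
  have hA : 0 ≤ (∫ x, gradSq u x) ^ (1 / 2 : ℝ) := Real.rpow_nonneg hG0 _
  have hH : 0 ≤ (∫ x, hessSq u x) ^ (1 / 2 : ℝ) :=
    Real.rpow_nonneg (integral_nonneg (hessSq_nonneg u)) _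
  have hAsq : ((∫ x, gradSq u x) ^ (1 / 2 : ℝ)) ^ 2 = ∫ x, gradSq u x := by
    rw [← Real.sqrt_eq_rpow, Real.sq_sqrt hG0]
  have hsup := ciSup_le (hC u hsm hc)
  have h6 := integral_sqrt_gradSq_pow_six_le hsm hc
  rw [← hS] at h6
  set A := (∫ x, gradSq u x) ^ (1 / 2 : ℝ)
  set H := (∫ x, hessSq u x) ^ (1 / 2 : ℝ)
  have hLq : (∫ x, Real.sqrt (gradSq u x) ^ q) ^ (1 / q) ≤ K * (A + H) := by
    refine le_of_forall_gt_imp_ge_of_dense fun b hb => ?_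
    have hM : 0 < b / K := div_pos (lt_of_le_of_lt (by positivity) hb) hK0
    have hAH : A + H ≤ b / K := by
      rw [le_div_iff₀ hK0]; linarith
    have := integral_rpow_rpow_inv_le (continuous_gradSq hsm).sqrt
      (hasCompactSupport_sqrt (hasCompactSupport_gradSq hc)) (fun x => Real.sqrt_nonneg _)
      hq2 hq6 hM (D := 3 * (S : ℝ)) ?_ ?_
    · rwa [← hK, mul_div_cancel₀ _ hK0.ne'] at this
    · simp only [Real.sq_sqrt (gradSq_nonneg u _)]
      rw [← hAsq]
      gcongr
      linarith
    · refine h6.trans ?_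
      gcongr
      linarith
  have hCN : 0 ≤ (C + K) * N := by positivity
  linarith
end
end
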